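/- Suppose K is an infinite field. Then Q(B) = B if and only if μ_i − μ_{i+1} ≥ 2 for all i = 1,...,t−1; equivalently, every nilpotent A commuting with J satisfies rank A^m ≤ rank J^m for all m ∈ ℕ if and only if consecutive parts of B differ by at least 2. -/

import Mathlib

open Matrix

/-- The Jordan matrix of the partition `μ`. -/
def jordanMatrix (K : Type*) [Field K] (t : ℕ) (μ : Fin t → ℕ) :
    Matrix (Σ i : Fin t, Fin (μ i)) (Σ i : Fin t, Fin (μ i)) K :=
  fun p q => if p.1 = q.1 ∧ (p.2 : ℕ) + 1 = (q.2 : ℕ) then 1 else 0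

namespace Matrix

variable {ι K : Type*} [Fintype ι] [Field K]

lemma rank_add_le_rank_add_rank (A B : Matrix ι ι K) : (A + B).rank ≤ A.rank + B.rank := by
  have hle : LinearMap.range (A + B).mulVecLin ≤
      LinearMap.range A.mulVecLin ⊔ LinearMap.range B.mulVecLin := by
    rw [mulVecLin_add]
    exact LinearMap.range_add_le _ _
  exact (Submodule.finrank_mono hle).trans (Submodule.finrank_add_le_finrank_add_finrank _ _)

lemma rank_lt_rank_of_ker {A B C : Matrix ι ι K} (hB : B = C * A) (v : ι → K)
    (hBv : B *ᵥ v = 0) (hAv : A *ᵥ v ≠ 0) : B.rank < A.rank := by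
  have hlt : LinearMap.ker A.mulVecLin < LinearMap.ker B.mulVecLin := by
    refine lt_of_le_of_ne (fun w hw => ?_) fun h => hAv ?_
    · rw [LinearMap.mem_ker, mulVecLin_apply] at hw ⊢
      rw [hB, ← mulVec_mulVec, hw, mulVec_zero]
    · have : v ∈ LinearMap.ker B.mulVecLin := hBv
      rw [← h] at this
      exact this
  have h₁ := Submodule.finrank_lt_finrank_of_lt hlt
  have h₂ := A.mulVecLin.finrank_range_add_finrank_ker
  have h₃ := B.mulVecLin.finrank_range_add_finrank_ker
  unfold rank
  omega

variable [DecidableEq ι]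

/-- If every nonzero entry of `A` raises the height `g` by at least one, then every nonzero entry
of `A ^ m` raises it by at least `m`. -/
lemma height_add_le_of_pow_apply_ne_zero {A : Matrix ι ι K} {g : ι → ℕ}
    (hA : ∀ p q, A p q ≠ 0 → g p < g q) (m : ℕ) :
    ∀ p q, (A ^ m) p q ≠ 0 → g p + m ≤ g q := by
  induction m with
  | zero =>
    intro p q h
    rw [pow_zero] at h
    have : p = q := by
      by_contra hne
      exact h (one_apply_ne hne)
    simp [this]
  | succ m ih =>
    intro p q h
    rw [pow_succ, mul_apply] at h
    obtain ⟨r, -, hr⟩ := Finset.exists_ne_zero_of_sum_ne_zero h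
    have h₁ := ih p r (left_ne_zero_of_mul hr)
    have h₂ := hA r q (right_ne_zero_of_mul hr)
    omega

lemma isNilpotent_of_height_lt {A : Matrix ι ι K} {g : ι → ℕ}
    (hA : ∀ p q, A p q ≠ 0 → g p < g q) : IsNilpotent A := by
  refine ⟨Finset.univ.sup g + 1, ?_⟩
  ext p q
  by_contra h
  have h₁ := height_add_le_of_pow_apply_ne_zero hA _ p q h
  have h₂ : g q ≤ Finset.univ.sup g := Finset.le_sup (Finset.mem_univ q)
  omega

/-- The diagonal entries of a power of a triangular matrix. -/
lemma pow_apply_self_of_height {A : Matrix ι ι K} {g : ι → ℕ}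
    (hA : ∀ p q, A p q ≠ 0 → g p < g q ∨ p = q) (m : ℕ) :
    (∀ p q, (A ^ m) p q ≠ 0 → g p < g q ∨ p = q) ∧ ∀ p, (A ^ m) p p = A p p ^ m := by
  induction m with
  | zero =>
    refine ⟨fun p q h => Or.inr ?_, by simp⟩
    by_contra hne
    exact h (by rw [pow_zero, one_apply_ne hne])
  | succ m ih =>
    obtain ⟨ih₁, ih₂⟩ := ih
    constructor
    · intro p q h
      rw [pow_succ, mul_apply] at h
      obtain ⟨r, -, hr⟩ := Finset.exists_ne_zero_of_sum_ne_zero h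
      rcases ih₁ p r (left_ne_zero_of_mul hr) with h₁ | rfl
      · rcases hA r q (right_ne_zero_of_mul hr) with h₂ | rfl
        · exact Or.inl (h₁.trans h₂)
        · exact Or.inl h₁
      · exact hA p q (right_ne_zero_of_mul hr)
    · intro p
      rw [pow_succ, mul_apply, Finset.sum_eq_single p, ih₂, pow_succ]
      · intro r _ hr
        by_contra h
        rcases ih₁ p r (left_ne_zero_of_mul h) with h₁ | h₁
        · rcases hA r p (right_ne_zero_of_mul h) with h₂ | h₂
          · omega
          · exact hr h₂
        · exact hr h₁.symm
      · simp

/-- A nilpotent triangular matrix is strictly triangular. -/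
lemma height_lt_of_isNilpotent {A : Matrix ι ι K} {g : ι → ℕ}
    (hA : ∀ p q, A p q ≠ 0 → g p < g q ∨ p = q) (hnil : IsNilpotent A) :
    ∀ p q, A p q ≠ 0 → g p < g q := by
  intro p q h
  rcases hA p q h with h₁ | rfl
  · exact h₁
  · obtain ⟨k, hk⟩ := hnil
    have := (pow_apply_self_of_height hA k).2 p
    rw [hk, zero_apply] at this
    exact absurd (eq_zero_of_pow_eq_zero this.symm) h

/-- A matrix whose nonzero entries lie in the rows satisfying `P` or the columns satisfying `Q`
has rank at most the number of these rows and columns. -/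
lemma rank_le_card_add_card {B : Matrix ι ι K} (P Q : ι → Prop) [DecidablePred P]
    [DecidablePred Q] (hB : ∀ p q, B p q ≠ 0 → P p ∨ Q q) :
    B.rank ≤ (Finset.univ.filter P).card + (Finset.univ.filter Q).card := by
  have hrank : ∀ (R : ι → Prop) [DecidablePred R],
      (diagonal fun p => if R p then (1 : K) else 0).rank = (Finset.univ.filter R).card := by
    intro R _
    classical
    rw [rank_diagonal, Fintype.card_subtype]
    congr 1
    ext p
    simp
  have hdecomp : B = (diagonal fun p => if P p then (1 : K) else 0) * B +
      ((diagonal fun p => if P p then (0 : K) else 1) * B) *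
        (diagonal fun q => if Q q then (1 : K) else 0) := by
    ext p q
    rw [add_apply, mul_diagonal, diagonal_mul, diagonal_mul]
    have := hB p q
    by_cases hP : P p <;> by_cases hQ : Q q <;> simp_all
  rw [hdecomp]
  refine (rank_add_le_rank_add_rank _ _).trans (add_le_add ?_ ?_)
  · exact (rank_mul_le_left _ _).trans (hrank P).le
  · exact (rank_mul_le_right _ _).trans (hrank Q).le

/-- The matrix of a partially defined self-map of the standard basis. -/
def ofPartialMap (K : Type*) [Field K] (f : ι → Option ι) : Matrix ι ι K :=
  fun p q => if f q = some p then 1 else 0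

lemma ofPartialMap_mul (f g : ι → Option ι) :
    ofPartialMap K f * ofPartialMap K g = ofPartialMap K fun q => (g q).bind f := by
  ext p q
  rw [mul_apply]
  cases h : g q with
  | none => simp [ofPartialMap, h]
  | some r => simp [ofPartialMap, h]

end Matrix

section JordanMatrix

variable {K : Type*} [Field K] {t : ℕ} {μ : Fin t → ℕ}

lemma jordanMatrix_pow_apply (m : ℕ) (p q : Σ i : Fin t, Fin (μ i)) :
    (jordanMatrix K t μ ^ m) p q =
      if p.1 = q.1 ∧ (p.2 : ℕ) + m = (q.2 : ℕ) then 1 else 0 := by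
  induction m generalizing p with
  | zero =>
    rw [pow_zero, Matrix.one_apply]
    congr 1
    obtain ⟨i, a⟩ := p
    obtain ⟨j, b⟩ := q
    apply propext
    constructor
    · intro h
      cases h
      simp
    · rintro ⟨h₁, h₂⟩
      dsimp only at h₁ h₂
      subst h₁
      rw [Fin.ext (by omega : (a : ℕ) = b)]
  | succ m ih =>
    obtain ⟨i, a⟩ := p
    obtain ⟨j, b⟩ := q
    rw [pow_succ', Matrix.mul_apply]
    by_cases ha : (a : ℕ) + 1 < μ i
    · rw [Finset.sum_eq_single ⟨i, ⟨a + 1, ha⟩⟩]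
      · rw [ih]
        simp [jordanMatrix, add_assoc, add_comm 1 m]
      · rintro ⟨k, c, hk⟩ - hc
        have : ¬ (i = k ∧ (a : ℕ) + 1 = c) := by
          rintro ⟨rfl, rfl⟩
          exact hc rfl
        simp [jordanMatrix, this]
      · simp
    · rw [Finset.sum_eq_zero, if_neg]
      · rintro ⟨rfl, h⟩
        have := b.2
        dsimp only at h
        omega
      · rintro ⟨k, c⟩ -
        have : ¬ (i = k ∧ (a : ℕ) + 1 = c) := by
          rintro ⟨rfl, h⟩
          have := c.2
          omega
        simp [jordanMatrix, this]

lemma card_le_rank_jordanMatrix_pow (m : ℕ) :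
    (Finset.univ.filter fun p : Σ i : Fin t, Fin (μ i) => (p.2 : ℕ) + m < μ p.1).card ≤
      (jordanMatrix K t μ ^ m).rank := by
  have hdiag : jordanMatrix K t μ ^ m * (jordanMatrix K t μ ^ m)ᵀ =
      Matrix.diagonal fun p => if (p.2 : ℕ) + m < μ p.1 then (1 : K) else 0 := by
    ext ⟨i, a⟩ ⟨j, b⟩
    rw [Matrix.mul_apply, Matrix.diagonal_apply]
    simp only [Matrix.transpose_apply, jordanMatrix_pow_apply]
    by_cases ha : (a : ℕ) + m < μ i
    · rw [Finset.sum_eq_single ⟨i, ⟨a + m, ha⟩⟩]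
      · by_cases hij : i = j
        · subst hij
          simp [ha, Fin.ext_iff, eq_comm]
        · simp [hij, Ne.symm hij]
      · rintro ⟨k, c, hk⟩ - hc
        have : ¬ (i = k ∧ (a : ℕ) + m = c) := by
          rintro ⟨rfl, rfl⟩
          exact hc rfl
        simp [this]
      · simp
    · rw [Finset.sum_eq_zero]
      · simp [ha]
      · rintro ⟨k, c⟩ -
        have : ¬ (i = k ∧ (a : ℕ) + m = c) := by
          rintro ⟨rfl, h⟩
          have := c.2
          omega
        simp [this]
  have h := Matrix.rank_mul_le_left (jordanMatrix K t μ ^ m) (jordanMatrix K t μ ^ m)ᵀ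
  classical
  rw [hdiag, Matrix.rank_diagonal, Fintype.card_subtype] at h
  refine le_trans (le_of_eq ?_) h
  congr 1
  ext p
  simp

section Commute

variable {A : Matrix (Σ i : Fin t, Fin (μ i)) (Σ i : Fin t, Fin (μ i)) K}

lemma mul_jordanMatrix_apply_zero (p : Σ i : Fin t, Fin (μ i)) (j : Fin t) (h : 0 < μ j) :
    (A * jordanMatrix K t μ) p ⟨j, ⟨0, h⟩⟩ = 0 := by
  simp [Matrix.mul_apply, jordanMatrix]

lemma mul_jordanMatrix_apply_succ (p : Σ i : Fin t, Fin (μ i)) (j : Fin t) (b : ℕ)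
    (h : b + 1 < μ j) :
    (A * jordanMatrix K t μ) p ⟨j, ⟨b + 1, h⟩⟩ = A p ⟨j, ⟨b, by omega⟩⟩ := by
  rw [Matrix.mul_apply, Finset.sum_eq_single ⟨j, ⟨b, by omega⟩⟩]
  · simp [jordanMatrix]
  · rintro ⟨k, c, hk⟩ - hc
    have : ¬ (k = j ∧ c = b) := by
      rintro ⟨rfl, rfl⟩
      exact hc rfl
    simp [jordanMatrix, this]
  · simp

lemma jordanMatrix_mul_apply_last (q : Σ i : Fin t, Fin (μ i)) (i : Fin t) (a : Fin (μ i))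
    (h : (a : ℕ) + 1 = μ i) : (jordanMatrix K t μ * A) ⟨i, a⟩ q = 0 := by
  rw [Matrix.mul_apply, Finset.sum_eq_zero]
  rintro ⟨k, c⟩ -
  have : ¬ (i = k ∧ (a : ℕ) + 1 = c) := by
    rintro ⟨rfl, h'⟩
    have := c.2
    omega
  simp [jordanMatrix, this]

lemma jordanMatrix_mul_apply_of_lt (q : Σ i : Fin t, Fin (μ i)) (i : Fin t) (a : ℕ)
    (h : a + 1 < μ i) :
    (jordanMatrix K t μ * A) ⟨i, ⟨a, by omega⟩⟩ q = A ⟨i, ⟨a + 1, h⟩⟩ q := by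
  rw [Matrix.mul_apply, Finset.sum_eq_single ⟨i, ⟨a + 1, h⟩⟩]
  · simp [jordanMatrix]
  · rintro ⟨k, c, hk⟩ - hc
    have : ¬ (i = k ∧ a + 1 = c) := by
      rintro ⟨rfl, rfl⟩
      exact hc rfl
    simp [jordanMatrix, this]
  · simp

/-- A matrix commuting with the Jordan matrix has upper triangular blocks. -/
lemma row_le_col_of_commute (hA : A * jordanMatrix K t μ = jordanMatrix K t μ * A)
    (i j : Fin t) (a : ℕ) : ∀ (b : ℕ) (ha : a < μ i) (hb : b < μ j),
      A ⟨i, ⟨a, ha⟩⟩ ⟨j, ⟨b, hb⟩⟩ ≠ 0 → a ≤ b := by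
  induction a with
  | zero => intros; omega
  | succ a ih =>
    intro b ha hb h
    have h₁ := jordanMatrix_mul_apply_of_lt (A := A) ⟨j, ⟨b, hb⟩⟩ i a ha
    rw [← hA] at h₁
    cases b with
    | zero => exact absurd (h₁.symm.trans (mul_jordanMatrix_apply_zero _ _ _)) h
    | succ b =>
      have := ih b _ _ (((mul_jordanMatrix_apply_succ _ _ _ _).symm.trans h₁).trans_ne h)
      omega

/-- The blocks of a matrix commuting with the Jordan matrix are upper triangular also when aligned
at their last rows and columns. -/
lemma size_sub_col_le_of_commute (hA : A * jordanMatrix K t μ = jordanMatrix K t μ * A)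
    (i j : Fin t) (d : ℕ) : ∀ (a b : ℕ) (ha : a < μ i) (hb : b < μ j), a + 1 + d = μ i →
      A ⟨i, ⟨a, ha⟩⟩ ⟨j, ⟨b, hb⟩⟩ ≠ 0 → μ j ≤ b + 1 + d := by
  induction d with
  | zero =>
    intro a b ha hb hd h
    by_contra hlt
    have h₁ := mul_jordanMatrix_apply_succ (A := A) ⟨i, ⟨a, ha⟩⟩ j b (by omega)
    rw [hA] at h₁
    exact h (h₁.symm.trans (jordanMatrix_mul_apply_last _ _ _ hd))
  | succ d ih =>
    intro a b ha hb hd h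
    by_cases hlt : b + 1 < μ j
    · have h₁ := mul_jordanMatrix_apply_succ (A := A) ⟨i, ⟨a, ha⟩⟩ j b hlt
      rw [hA] at h₁
      have h₂ := jordanMatrix_mul_apply_of_lt (A := A) ⟨j, ⟨b + 1, hlt⟩⟩ i a (by omega)
      have := ih _ _ _ _ (by omega) ((h₂.symm.trans h₁).trans_ne h)
      omega
    · omega

end Commute

lemma add_two_mul_le_of_gap (hgap : ∀ i : Fin t, ∀ h : (i : ℕ) + 1 < t, μ ⟨i + 1, h⟩ + 2 ≤ μ i)
    (i : Fin t) (d : ℕ) : ∀ h : (i : ℕ) + d < t, μ ⟨i + d, h⟩ + 2 * d ≤ μ i := by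
  induction d with
  | zero => intro h; simp
  | succ d ih =>
    intro h
    have h₁ := ih (by omega)
    have h₂ := hgap ⟨i + d, by omega⟩ h
    have h₃ : μ ⟨i + (d + 1), h⟩ = μ ⟨i + d + 1, h⟩ := rfl
    dsimp only at h₂
    omega

/-- The intervals `[i, i + μ i)` are nested, so for every length `m` there is a window
`[s, s + m)` comparable with all of them. -/
lemma exists_window (hgap : ∀ i j : Fin t, i ≤ j → μ j + 2 * ((j : ℕ) - i) ≤ μ i) (m : ℕ) :
    ∃ s : ℕ, ∀ i : Fin t, (s ≤ i ∧ i + μ i ≤ s + m) ∨ ((i : ℕ) ≤ s ∧ s + m ≤ i + μ i) := by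
  set f : Fin t → ℕ := fun i => min (i : ℕ) (i + μ i - m) with hf
  refine ⟨Finset.univ.sup f, fun i => ?_⟩
  have hi : f i ≤ Finset.univ.sup f := Finset.le_sup (Finset.mem_univ i)
  obtain ⟨j, -, hj⟩ := Finset.exists_mem_eq_sup Finset.univ ⟨i, Finset.mem_univ i⟩ f
  rw [hj] at hi ⊢
  simp only [hf] at hi ⊢
  rcases le_total i j with h | h
  · have := hgap i j h
    have h' : (i : ℕ) ≤ j := h
    omega
  · have := hgap j i h
    have h' : (j : ℕ) ≤ i := h
    omega

lemma rank_pow_le_of_gap (hgap : ∀ i j : Fin t, i ≤ j → μ j + 2 * ((j : ℕ) - i) ≤ μ i)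
    {A : Matrix (Σ i : Fin t, Fin (μ i)) (Σ i : Fin t, Fin (μ i)) K}
    (hA : A * jordanMatrix K t μ = jordanMatrix K t μ * A) (hnil : IsNilpotent A) (m : ℕ) :
    (A ^ m).rank ≤ (jordanMatrix K t μ ^ m).rank := by
  set g : (Σ i : Fin t, Fin (μ i)) → ℕ := fun p => p.1 + p.2 with hg
  have htri : ∀ p q, A p q ≠ 0 → g p < g q ∨ p = q := by
    rintro ⟨i, a, ha⟩ ⟨j, b, hb⟩ h
    have h₁ := row_le_col_of_commute hA i j a b ha hb h
    have h₂ := size_sub_col_le_of_commute hA i j (μ i - (a + 1)) a b ha hb (by omega) h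
    simp only [hg]
    rcases lt_trichotomy i j with hij | rfl | hij
    · have h' : (i : ℕ) < j := hij
      left
      omega
    · rcases h₁.lt_or_eq with h | rfl
      · left
        omega
      · exact Or.inr rfl
    · have := hgap j i hij.le
      have h' : (j : ℕ) < i := hij
      left
      omega
  have hpow := Matrix.height_add_le_of_pow_apply_ne_zero
    (Matrix.height_lt_of_isNilpotent htri hnil) m
  obtain ⟨s, hs⟩ := exists_window hgap m
  refine (Matrix.rank_le_card_add_card (fun p => g p < s) (fun q => s + m ≤ g q) ?_).trans
    (le_trans ?_ (card_le_rank_jordanMatrix_pow m))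
  · intro p q h
    have := hpow p q h
    omega
  rw [← Finset.card_union_of_disjoint]
  swap
  · rw [Finset.disjoint_filter]
    intro p _ _
    omega
  refine Finset.card_le_card_of_injOn
    (fun p => if g p < s then p else ⟨p.1, ⟨p.2 - m, by omega⟩⟩) ?_ ?_
  · rintro ⟨i, a, ha⟩ h
    simp only [Finset.coe_union, Finset.coe_filter, Finset.mem_univ, true_and, Set.mem_union,
      Set.mem_ofPred_eq, hg] at h ⊢
    have := hs i
    by_cases h' : (i : ℕ) + a < s
    · rw [if_pos h']
      dsimp only
      omega
    · rw [if_neg h']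
      dsimp only
      omega
  · rintro ⟨i, a, ha⟩ h ⟨j, b, hb⟩ h' heq
    simp only [Finset.coe_union, Finset.coe_filter, Finset.mem_univ, true_and, Set.mem_union,
      Set.mem_ofPred_eq, hg] at h h' heq
    have hij : i = j := by
      have := congrArg Sigma.fst heq
      split_ifs at this <;> exact this
    subst hij
    have hab : a = b := by
      have := hs i
      split_ifs at heq <;>
        simp only [Sigma.mk.injEq, heq_eq_eq, true_and, Fin.mk.injEq] at heq <;> omega
    subst hab
    rfl

/-- The partial map whose matrix is the Jordan matrix. -/
def jordanMap (μ : Fin t → ℕ) (p : Σ i : Fin t, Fin (μ i)) : Option (Σ i : Fin t, Fin (μ i)) :=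
  if 0 < (p.2 : ℕ) then some ⟨p.1, ⟨p.2 - 1, by omega⟩⟩ else none

lemma ofPartialMap_jordanMap : Matrix.ofPartialMap K (jordanMap μ) = jordanMatrix K t μ := by
  ext ⟨i, a⟩ ⟨j, b⟩
  unfold Matrix.ofPartialMap jordanMatrix jordanMap
  congr 1
  apply propext
  dsimp only
  constructor
  · intro h
    split_ifs at h with hb
    cases h
    dsimp only
    exact ⟨rfl, by omega⟩
  · rintro ⟨rfl, h⟩
    rw [if_pos (by omega)]
    congr 3
    omega

/-- The partial map threading two blocks of nearly equal sizes into a single one. -/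
def threadMap {i j : Fin t} (hji : μ j ≤ μ i) (hij : μ i ≤ μ j + 1)
    (p : Σ i : Fin t, Fin (μ i)) : Option (Σ i : Fin t, Fin (μ i)) :=
  if hi : p.1 = i then
    if h : 0 < (p.2 : ℕ) then some ⟨j, ⟨p.2 - 1, by have := p.2.2; have := congrArg μ hi; omega⟩⟩
    else none
  else if hj : p.1 = j then some ⟨i, ⟨p.2, by have := p.2.2; have := congrArg μ hj; omega⟩⟩
  else jordanMap μ p

lemma exists_rank_gt {i j : Fin t} (hne : i ≠ j) (hpos : 0 < μ j) (hji : μ j ≤ μ i)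
    (hij : μ i ≤ μ j + 1) :
    ∃ A : Matrix (Σ i : Fin t, Fin (μ i)) (Σ i : Fin t, Fin (μ i)) K,
      A * jordanMatrix K t μ = jordanMatrix K t μ * A ∧ IsNilpotent A ∧
        (jordanMatrix K t μ).rank < A.rank := by
  refine ⟨Matrix.ofPartialMap K (threadMap hji hij), ?_, ?_, ?_⟩
  · rw [← ofPartialMap_jordanMap, Matrix.ofPartialMap_mul, Matrix.ofPartialMap_mul]
    congr 1
    funext ⟨k, a, ha⟩
    by_cases hk : k = i
    · subst hk
      rcases a with _ | _ | a <;> simp [threadMap, jordanMap]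
    · by_cases hk' : k = j
      · subst hk'
        rcases a with _ | a <;> simp [threadMap, jordanMap, hk]
      · rcases a with _ | _ | a <;> simp [threadMap, jordanMap, hk, hk']
  · apply Matrix.isNilpotent_of_height_lt (g := fun p => 2 * p.2 + if p.1 = j then 1 else 0)
    intro p ⟨k, a, ha⟩ h
    have h : threadMap hji hij ⟨k, a, ha⟩ = some p := by
      by_contra h'
      exact h (if_neg h')
    unfold threadMap jordanMap at h
    dsimp only at h ⊢
    split_ifs at h with h₁ h₂ h₃ h₄ <;> cases h <;> simp_all
    omega
  · refine Matrix.rank_lt_rank_of_ker (C := Matrix.ofPartialMap K fun p =>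
      if p.1 = i ∨ p.1 = j then threadMap hji hij p else some p) ?_
      (Pi.single ⟨j, ⟨0, hpos⟩⟩ 1) ?_ fun h => ?_
    · rw [← ofPartialMap_jordanMap, Matrix.ofPartialMap_mul]
      congr 1
      funext ⟨k, a, ha⟩
      by_cases hk : k = i
      · subst hk
        rcases a with _ | a <;> simp [threadMap, jordanMap, hne.symm]
      · by_cases hk' : k = j
        · subst hk'
          rcases a with _ | a <;> simp [threadMap, jordanMap, hk]
        · rcases a with _ | a <;> simp [threadMap, jordanMap, hk, hk']
    · ext p
      simp [jordanMatrix]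
    · have := congrFun h ⟨i, ⟨0, by omega⟩⟩
      simp [Matrix.ofPartialMap, threadMap, hne.symm] at this

end JordanMatrix

/-- Suppose `K` is an infinite field.  Then `Q(B) = B`, i.e. every nilpotent `A` commuting
with the Jordan matrix `J` of type `B` satisfies `rank A^m ≤ rank J^m` for all `m`, if and
only if consecutive parts of `B` differ by at least `2`: `μ_i - μ_{i+1} ≥ 2` for
`i = 1, ..., t-1`. -/
theorem QB_eq_B_iff
    (K : Type*) [Field K] [Infinite K]
    (t : ℕ) (μ : Fin t → ℕ) (hpos : ∀ i, 0 < μ i)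
    (hmono : ∀ i j : Fin t, i ≤ j → μ j ≤ μ i) :
    (∀ A : Matrix (Σ i : Fin t, Fin (μ i)) (Σ i : Fin t, Fin (μ i)) K,
        A * jordanMatrix K t μ = jordanMatrix K t μ * A → IsNilpotent A →
        ∀ m : ℕ, (A ^ m).rank ≤ (jordanMatrix K t μ ^ m).rank) ↔
    (∀ i : Fin t, ∀ h : (i : ℕ) + 1 < t, μ ⟨(i : ℕ) + 1, h⟩ + 2 ≤ μ i) := by
  constructor
  · intro H i h
    by_contra hlt
    have hle : i ≤ ⟨(i : ℕ) + 1, h⟩ := Fin.mk_le_mk.2 (Nat.le_succ _)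
    obtain ⟨A, hA, hnil, hrank⟩ := exists_rank_gt (K := K) (i := i) (j := ⟨(i : ℕ) + 1, h⟩)
      (fun heq => by simpa using congrArg Fin.val heq) (hpos _) (hmono _ _ hle) (by omega)
    have := H A hA hnil 1
    rw [pow_one, pow_one] at this
    omega
  · intro hgap A hA hnil m
    refine rank_pow_le_of_gap (fun i j hij => ?_) hA hnil m
    have hij' : (i : ℕ) ≤ j := hij
    have := add_two_mul_le_of_gap hgap i (j - i) (by omega)
    have hj : (⟨(i : ℕ) + (j - i), by omega⟩ : Fin t) = j := Fin.ext (by dsimp only; omega)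
    rwa [hj] at this
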